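/- There is an absolute constant K > 0 such that the following holds for m square-free with least prime factor p_1 = P^-(m) sufficiently large. Let t = ω(m), let l be a positive integer with l < p_1, let C_1 = {0, l}, and let C_2 be a set of non-negative integers less than p_1 disjoint from C_1, with s = |C_2| ≤ 0.13·2^t·log p_1 and t ≤ p_1^{0.01}. Then ||RN_m(C_1,C_2)| − m·2^{−2t}·(1 − 2^{−t})^s| ≤ K·m·2^{−2t}·(1 + 2^{1−t})^s·p_1^{−0.48}. -/

import Mathlib

open Finset

/-- The set of quadratic residues modulo `M`, as a finset of `ZMod M`. -/
def QR (M : ℕ) : Finset (ZMod M) := (Finset.range M).image (fun a : ℕ => ((a : ZMod M)) ^ 2)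

/-- The "universe" finset of `ZMod M` (all residues), valid for any `M ≥ 1`. -/
def univM (M : ℕ) : Finset (ZMod M) := (Finset.range M).image (fun a : ℕ => (a : ZMod M))

/-- `RN_M(C₁, C₂)` for `C₁, C₂ ⊆ Z_M`: the set of `x ∈ Z_M` with `x + c₁ ∈ R_M` for all
`c₁ ∈ C₁` and `x + c₂ ∉ R_M` for all `c₂ ∈ C₂`. -/
def RNsetZ (M : ℕ) (C₁ C₂ : Finset (ZMod M)) : Finset (ZMod M) :=
  (univM M).filter (fun x => (∀ c ∈ C₁, x + c ∈ QR M) ∧ (∀ c ∈ C₂, x + c ∉ QR M))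

/-- `RN_M(C₁, C₂)` for sets `C₁, C₂` of non-negative integers, identified with their
residues in `Z_M`. -/
def RNset (M : ℕ) (C₁ C₂ : Finset ℕ) : Finset (ZMod M) :=
  (univM M).filter
    (fun x => (∀ c ∈ C₁, x + (c : ZMod M) ∈ QR M) ∧ (∀ c ∈ C₂, x + (c : ZMod M) ∉ QR M))

/-- `N_M(C)` for a set `C` of non-negative integers (identified with residues in `Z_M`):
the set of `x ∈ Z_M` with `x + c ∉ R_M` for all `c ∈ C`. -/
def Nset (M : ℕ) (C : Finset ℕ) : Finset (ZMod M) :=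
  (univM M).filter (fun x => ∀ c ∈ C, x + (c : ZMod M) ∉ QR M)

open Polynomial in
/-- For `k ≤ N`, the linear map on polynomials sending `r` to the quotient of
`derivative^[k] (f ^ N * r)` by `f ^ (N - k)`. -/
noncomputable def derivQuot {R : Type*} [CommRing R] (f : R[X]) (N : ℕ) : ℕ → R[X] →ₗ[R] R[X]
  | 0 => LinearMap.id
  | k + 1 => (N - k : ℕ) • (LinearMap.mulLeft R (derivative f) ∘ₗ derivQuot f N k) +
      LinearMap.mulLeft R f ∘ₗ derivative ∘ₗ derivQuot f N k

section Stepanov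

open Polynomial

lemma derivQuot_succ_apply {R : Type*} [CommRing R] (f : R[X]) (N k : ℕ) (r : R[X]) :
    derivQuot f N (k + 1) r = ((N - k : ℕ) : R[X]) * (derivative f * derivQuot f N k r) +
      f * derivative (derivQuot f N k r) := by
  simp [derivQuot]

lemma iterate_derivative_pow_mul {R : Type*} [CommRing R] (f r : R[X]) {N k : ℕ} (hk : k ≤ N) :
    derivative^[k] (f ^ N * r) = f ^ (N - k) * derivQuot f N k r := by
  induction k with
  | zero => simp [derivQuot]
  | succ k ih =>
    obtain ⟨n, rfl⟩ : ∃ n, N = n + 1 + k := ⟨N - (k + 1), by omega⟩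
    rw [Function.iterate_succ_apply', ih (by omega), derivQuot_succ_apply]
    have h1 : n + 1 + k - k = n + 1 := by omega
    have h2 : n + 1 + k - (k + 1) = n := by omega
    rw [h1, h2, derivative_mul, derivative_pow]
    simp
    ring

lemma iterate_derivative_mul_of_derivative_eq_zero {R : Type*} [CommRing R] (r : R[X]) {e : R[X]}
    (he : derivative e = 0) (k : ℕ) : derivative^[k] (r * e) = derivative^[k] r * e := by
  induction k with
  | zero => rfl
  | succ k ih => simp [Function.iterate_succ_apply', ih, he]

lemma degree_mul_lt_of_le_of_lt {R : Type*} [CommRing R] {a b : R[X]} {m n : ℕ}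
    (ha : a.degree ≤ m) (hb : b.degree < n) : (a * b).degree < ((n + m : ℕ) : WithBot ℕ) := by
  by_cases h : b = 0
  · subst h
    simp
  · rw [degree_eq_natDegree h] at hb
    calc (a * b).degree ≤ a.degree + b.degree := degree_mul_le _ _
      _ ≤ (m : WithBot ℕ) + b.natDegree := by
        rw [degree_eq_natDegree h]; gcongr
      _ < ((n + m : ℕ) : WithBot ℕ) := by
        norm_cast at hb ⊢; omega

lemma degree_derivQuot_lt {R : Type*} [CommRing R] {f r : R[X]} {m d : ℕ} (hf : f.degree ≤ m)
    (hr : r.degree < d) (N k : ℕ) :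
    (derivQuot f N k r).degree < ((d + k * m : ℕ) : WithBot ℕ) := by
  induction k with
  | zero => simpa [derivQuot] using hr
  | succ k ih =>
    rw [derivQuot_succ_apply, show d + (k + 1) * m = d + k * m + m by ring]
    refine lt_of_le_of_lt (degree_add_le _ _) (max_lt ?_ ?_)
    · have h := degree_mul_lt_of_le_of_lt ((degree_derivative_le).trans hf) ih
      have h0 : (((N - k : ℕ) : R[X])).degree ≤ ((0 : ℕ) : WithBot ℕ) := by
        simpa using degree_natCast_le (R := R) (N - k)
      simpa using degree_mul_lt_of_le_of_lt h0 h
    · exact degree_mul_lt_of_le_of_lt hf (degree_derivative_le.trans_lt ih)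

variable {p : ℕ} [Fact p.Prime]

lemma eq_zero_of_X_pow_dvd_add_mul_pow (hp : p ≠ 2) {S : Finset (ZMod p)} (hS : S.Nonempty)
    (h0 : (0 : ZMod p) ∉ S) {d : ℕ} (hd : 2 * d + #S ≤ p) {r s : (ZMod p)[X]}
    (hr : r.degree < d) (hs : s.degree < d)
    (h : X ^ p ∣ r + s * (∏ c ∈ S, (X - C c)) ^ (p / 2)) : r = 0 ∧ s = 0 := by
  set f : (ZMod p)[X] := ∏ c ∈ S, (X - C c) with hf
  have hfm : f.Monic := monic_prod_of_monic _ _ fun c _ => monic_X_sub_C c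
  have hfdeg : f.degree ≤ (#S : ℕ) := by
    rw [hf, degree_prod]; simp
  have hp1 : 2 * (p / 2) + 1 = p := by
    have := (Fact.out : p.Prime).eq_two_or_odd
    omega
  have hf0 : f.eval 0 ≠ 0 := by
    rw [hf, eval_prod, Finset.prod_ne_zero_iff]
    intro c hc
    simp only [eval_sub, eval_X, eval_C, zero_sub, ne_eq, neg_eq_zero]
    rintro rfl
    exact h0 hc
  have h1 : X ^ p ∣ r ^ 2 * f - s ^ 2 * f ^ p := by
    have : r ^ 2 * f - s ^ 2 * f ^ p = (r + s * f ^ (p / 2)) * ((r - s * f ^ (p / 2)) * f) := by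
      have : f ^ p = (f ^ (p / 2)) ^ 2 * f := by
        rw [← pow_mul, ← pow_succ, mul_comm, hp1]
      rw [this]; ring
    rw [this]
    exact dvd_mul_of_dvd_left h _
  have h2 : X ^ p ∣ f ^ p - C (f.eval 0) := by
    have h3 : (X : (ZMod p)[X]) ∣ f - C (f.eval 0) := by
      have := X_sub_C_dvd_sub_C_eval (p := f) (a := 0)
      simpa using this
    obtain ⟨q, hq⟩ := h3
    refine ⟨q ^ p, ?_⟩
    rw [← mul_pow, ← hq, sub_pow_char, ← C_pow, ZMod.pow_card]
  have h4 : X ^ p ∣ r ^ 2 * f - s ^ 2 * C (f.eval 0) := by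
    have : r ^ 2 * f - s ^ 2 * C (f.eval 0) =
      (r ^ 2 * f - s ^ 2 * f ^ p) + s ^ 2 * (f ^ p - C (f.eval 0)) := by ring
    rw [this]
    exact dvd_add h1 (dvd_mul_of_dvd_right h2 _)
  have hdpos : 0 < p := (Fact.out : p.Prime).pos
  have sqdeg : ∀ {u : (ZMod p)[X]}, u.degree < d → (u ^ 2).degree < ((2 * d : ℕ) : WithBot ℕ) := by
    intro u hu
    rw [sq, two_mul]
    exact degree_mul_lt_of_le_of_lt hu.le hu
  have h5 : r ^ 2 * f - s ^ 2 * C (f.eval 0) = 0 := by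
    refine eq_zero_of_dvd_of_degree_lt h4 ?_
    rw [degree_X_pow]
    refine lt_of_le_of_lt (degree_sub_le _ _) (max_lt ?_ ?_)
    · rw [mul_comm]
      exact (degree_mul_lt_of_le_of_lt hfdeg (sqdeg hr)).trans_le (by exact_mod_cast hd)
    · rw [mul_comm]
      refine (degree_mul_lt_of_le_of_lt (m := 0) (by simpa using degree_C_le) (sqdeg hs)).trans_le ?_
      norm_cast; omega
  have h6 : r ^ 2 * f = s ^ 2 * C (f.eval 0) := sub_eq_zero.mp h5
  have hC : (C (f.eval 0) : (ZMod p)[X]) ≠ 0 := C_ne_zero.mpr hf0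
  by_cases hr0 : r = 0
  · refine ⟨hr0, ?_⟩
    rw [hr0] at h6
    simp only [ne_eq, OfNat.ofNat_ne_zero, not_false_eq_true, zero_pow, zero_mul] at h6
    have := (mul_eq_zero.mp h6.symm).resolve_right hC
    exact pow_eq_zero_iff (two_ne_zero) |>.mp this
  · exfalso
    have hs0 : s ≠ 0 := by
      rintro rfl
      simp [hfm.ne_zero, hr0] at h6
    obtain ⟨z, hz⟩ := hS
    have h7 : rootMultiplicity z f = 1 := by
      rw [← count_roots, hf, roots_prod_X_sub_C, Multiset.count_eq_one_of_mem S.nodup hz]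
    have h8 := congrArg (rootMultiplicity z) h6
    rw [rootMultiplicity_mul (mul_ne_zero (pow_ne_zero _ hr0) hfm.ne_zero),
      rootMultiplicity_mul (mul_ne_zero (pow_ne_zero _ hs0) hC), rootMultiplicity_C, h7, sq, sq,
      rootMultiplicity_mul (mul_ne_zero hr0 hr0), rootMultiplicity_mul (mul_ne_zero hs0 hs0)] at h8
    omega

lemma eq_zero_of_sum_add_mul_pow_eq_zero (hp : p ≠ 2) {S : Finset (ZMod p)} (hS : S.Nonempty)
    (h0 : (0 : ZMod p) ∉ S) {d : ℕ} (hd : 2 * d + #S ≤ p) {n : ℕ} {r s : Fin n → (ZMod p)[X]}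
    (hr : ∀ j, (r j).degree < d) (hs : ∀ j, (s j).degree < d)
    (h : ∑ j, (r j + s j * (∏ c ∈ S, (X - C c)) ^ (p / 2)) * X ^ (p * (j : ℕ)) = 0) :
    ∀ j, r j = 0 ∧ s j = 0 := by
  induction n with
  | zero => exact fun j => j.elim0
  | succ n ih =>
    rw [Fin.sum_univ_succ] at h
    have hX : ∀ (j : Fin n), (X : (ZMod p)[X]) ^ (p * ((j.succ : Fin (n + 1)) : ℕ)) =
        X ^ p * X ^ (p * (j : ℕ)) := by
      intro j; rw [← pow_add, Fin.val_succ]; ring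
    simp only [hX, Fin.val_zero, mul_zero, pow_zero, mul_one, mul_left_comm _ (X ^ p),
      ← Finset.mul_sum] at h
    have h0' := eq_zero_of_X_pow_dvd_add_mul_pow hp hS h0 hd (hr 0) (hs 0)
      ((dvd_add_left (dvd_mul_right _ _)).mp (h ▸ dvd_zero _))
    rw [h0'.1, h0'.2, zero_mul, add_zero, zero_add] at h
    have h1 := (mul_eq_zero.mp h).resolve_left (pow_ne_zero _ X_ne_zero)
    exact Fin.cases h0' (ih (fun j => hr _) (fun j => hs _) h1)


lemma exists_auxiliary_coefficients (f : (ZMod p)[X]) (a : ZMod p) {m d n l : ℕ}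
    (hf : f.degree ≤ m) (hlt : l * (d + l * m + n) < 2 * d * n) :
    ∃ r s : Fin n → (ZMod p)[X], (∀ j, (r j).degree < d) ∧ (∀ j, (s j).degree < d) ∧
      (∃ j, r j ≠ 0 ∨ s j ≠ 0) ∧ ∀ k < l, ∑ j, (derivQuot f l k (r j) +
        a • derivQuot f (l + p / 2) k (s j)) * X ^ (j : ℕ) = 0 := by
  let Φ : (Fin n → degreeLT (ZMod p) d × degreeLT (ZMod p) d) →ₗ[ZMod p]
      (Fin l → Fin (d + l * m + n) → ZMod p) :=
    LinearMap.pi fun k => LinearMap.pi fun e => lcoeff (ZMod p) e ∘ₗ ∑ j : Fin n,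
      LinearMap.mulRight (ZMod p) (X ^ (j : ℕ)) ∘ₗ
        (derivQuot f l k ∘ₗ Submodule.subtype _ ∘ₗ LinearMap.fst _ _ _ +
          a • (derivQuot f (l + p / 2) k ∘ₗ Submodule.subtype _ ∘ₗ LinearMap.snd _ _ _)) ∘ₗ
        LinearMap.proj j
  have hfr : Module.finrank (ZMod p) (degreeLT (ZMod p) d) = d := by
    rw [(degreeLTEquiv (ZMod p) d).finrank_eq]; simp
  have : Module.Finite (ZMod p) (degreeLT (ZMod p) d) :=
    Module.Finite.equiv (degreeLTEquiv (ZMod p) d).symm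
  have hker : LinearMap.ker Φ ≠ ⊥ := by
    refine LinearMap.ker_ne_bot_of_finrank_lt ?_
    have h1 : Module.finrank (ZMod p) (Fin n → degreeLT (ZMod p) d × degreeLT (ZMod p) d) =
        n * (d + d) := by
      rw [Module.finrank_pi_fintype]; simp [hfr]
    have h2 : Module.finrank (ZMod p) (Fin l → Fin (d + l * m + n) → ZMod p) =
        l * (d + l * m + n) := by
      rw [Module.finrank_pi_fintype]; simp
    rw [h1, h2]
    linarith [hlt]
  obtain ⟨v, hv, hv0⟩ := (Submodule.ne_bot_iff _).mp hker
  have hdr : ∀ j, ((v j).1 : (ZMod p)[X]).degree < d := fun j => mem_degreeLT.mp (v j).1.2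
  have hds : ∀ j, ((v j).2 : (ZMod p)[X]).degree < d := fun j => mem_degreeLT.mp (v j).2.2
  refine ⟨fun j => (v j).1, fun j => (v j).2, hdr, hds, ?_, ?_⟩
  · by_contra! hcon
    apply hv0
    funext j
    ext1
    · exact Subtype.ext (hcon j).1
    · exact Subtype.ext (hcon j).2
  · intro k hk
    ext e
    by_cases he : e < d + l * m + n
    · have := congrFun (congrFun (LinearMap.mem_ker.mp hv) ⟨k, hk⟩) ⟨e, he⟩
      simpa [Φ] using this
    · rw [coeff_zero]
      apply coeff_eq_zero_of_degree_lt
      refine lt_of_lt_of_le ?_ (show ((d + l * m + n : ℕ) : WithBot ℕ) ≤ e by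
        exact_mod_cast not_lt.mp he)
      have hk' : d + k * m ≤ d + l * m := by gcongr
      refine lt_of_le_of_lt (degree_sum_le _ _) ((Finset.sup_lt_iff (WithBot.bot_lt_coe _)).mpr ?_)
      intro j _
      rw [mul_comm]
      have hadd : (derivQuot f l k ((v j).1 : (ZMod p)[X]) +
          a • derivQuot f (l + p / 2) k ((v j).2 : (ZMod p)[X])).degree <
            ((d + k * m : ℕ) : WithBot ℕ) :=
        lt_of_le_of_lt (degree_add_le _ _) (max_lt (degree_derivQuot_lt hf (hdr j) _ _)
          ((degree_smul_le _ _).trans_lt (degree_derivQuot_lt hf (hds j) _ _)))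
      refine (degree_mul_lt_of_le_of_lt (m := j) (by simp) hadd).trans_le ?_
      norm_cast
      have := j.2
      omega

lemma mul_card_filter_pow_eq_le (hp : p ≠ 2) {S : Finset (ZMod p)} (hS : S.Nonempty)
    (h0 : (0 : ZMod p) ∉ S) {d n l : ℕ} (hd : 2 * d + #S ≤ p) (hl : l ≤ p) (hl0 : 0 < l)
    (hlt : l * (d + l * #S + n) < 2 * d * n) (a : ZMod p) :
    l * #{x : ZMod p | (∏ c ∈ S, (x - c)) ^ (p / 2) = a} ≤
      (l + p / 2) * #S + d + p * n := by
  set f : (ZMod p)[X] := ∏ c ∈ S, (X - C c) with hf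
  have hfm : f.Monic := monic_prod_of_monic _ _ fun c _ => monic_X_sub_C c
  have hfdeg : f.degree ≤ (#S : ℕ) := by
    rw [hf, degree_prod]; simp
  have hfnat : f.natDegree = #S := by
    rw [hf, natDegree_prod_of_monic _ _ fun c _ => monic_X_sub_C c]; simp
  have hfeval : ∀ x, f.eval x = ∏ c ∈ S, (x - c) := fun x => by simp [hf, eval_prod]
  obtain ⟨r, s, hr, hs, ⟨i, hi⟩, hrs⟩ := exists_auxiliary_coefficients f a hfdeg hlt
  set Q : (ZMod p)[X] := ∑ j, (r j + s j * f ^ (p / 2)) * X ^ (p * (j : ℕ)) with hQ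
  have hQ0 : Q ≠ 0 := by
    intro h
    have := eq_zero_of_sum_add_mul_pow_eq_zero hp hS h0 hd hr hs h i
    tauto
  set P := f ^ l * Q with hP
  have hP0 : P ≠ 0 := mul_ne_zero (pow_ne_zero _ hfm.ne_zero) hQ0
  have hPeq : P = ∑ j, (f ^ l * r j + f ^ (l + p / 2) * s j) * X ^ (p * (j : ℕ)) := by
    rw [hP, hQ, Finset.mul_sum]
    refine Finset.sum_congr rfl fun j _ => ?_
    ring
  have hXd : ∀ j : ℕ, derivative (X ^ (p * j) : (ZMod p)[X]) = 0 := by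
    intro j; simp [derivative_X_pow]
  have hroot : ∀ x, (∏ c ∈ S, (x - c)) ^ (p / 2) = a → l ≤ rootMultiplicity x P := by
    intro x hx
    obtain ⟨l', rfl⟩ : ∃ l', l = l' + 1 := ⟨l - 1, by omega⟩
    refine lt_rootMultiplicity_of_isRoot_iterate_derivative_of_mem_nonZeroDivisors hP0 ?_ ?_
    · intro k hk
      have hk1 : k < l' + 1 := by omega
      have hz := congrArg (eval x) (hrs k hk1)
      rw [hPeq, iterate_derivative_sum, IsRoot.def, eval_finsetSum]
      rw [eval_finsetSum, eval_zero] at hz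
      rw [← mul_zero (f.eval x ^ (l' + 1 - k)), ← hz, Finset.mul_sum]
      refine Finset.sum_congr rfl fun j _ => ?_
      rw [iterate_derivative_mul_of_derivative_eq_zero _ (hXd j), iterate_map_add,
        iterate_derivative_pow_mul _ _ hk1.le, iterate_derivative_pow_mul _ _ (by omega)]
      have hpow : l' + 1 + p / 2 - k = (l' + 1 - k) + p / 2 := by omega
      rw [hpow]
      simp only [eval_mul, eval_add, eval_pow, eval_smul, eval_X, pow_mul x, ZMod.pow_card,
        pow_add (eval x f), smul_eq_mul]
      rw [hfeval, hx]
      ring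
    · rw [mem_nonZeroDivisors_iff_ne_zero, Ne, ZMod.natCast_eq_zero_iff,
        (Fact.out : p.Prime).dvd_factorial]
      omega
  have hcard : l * #{x : ZMod p | (∏ c ∈ S, (x - c)) ^ (p / 2) = a} ≤ P.natDegree := by
    refine le_trans ?_ (card_roots' P)
    rw [← Finset.card_val, ← Multiset.card_nsmul]
    refine Multiset.card_le_card (Multiset.le_iff_count.mpr fun x => ?_)
    rw [Multiset.count_nsmul, count_roots]
    by_cases hx : (∏ c ∈ S, (x - c)) ^ (p / 2) = a
    · rw [Multiset.count_eq_one_of_mem (Finset.nodup _) (by simpa using hx)]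
      simpa using hroot x hx
    · rw [Multiset.count_eq_zero_of_notMem (by simpa using hx)]
      simp
  refine hcard.trans ?_
  rw [hPeq]
  refine natDegree_sum_le_of_forall_le _ _ fun j _ => ?_
  have hrd : (r j).natDegree ≤ d := natDegree_le_of_degree_le (hr j).le
  have hsd : (s j).natDegree ≤ d := natDegree_le_of_degree_le (hs j).le
  have hfp : ∀ N, (f ^ N).natDegree = N * #S := fun N => by rw [hfm.natDegree_pow, hfnat]
  refine natDegree_mul_le.trans (add_le_add ?_ ?_)
  · refine (natDegree_add_le _ _).trans (max_le ?_ ?_)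
    · refine natDegree_mul_le.trans ?_
      rw [hfp]
      gcongr
      omega
    · refine natDegree_mul_le.trans ?_
      rw [hfp]
      gcongr
  · rw [natDegree_X_pow]
    exact Nat.mul_le_mul_left _ j.2.le

lemma card_filter_pow_eq_le_of_zero_notMem {S : Finset (ZMod p)} (hS : S.Nonempty)
    (h0 : (0 : ZMod p) ∉ S) (hSp : 100 * #S ^ 2 ≤ p) (a : ZMod p) :
    (#{x : ZMod p | (∏ c ∈ S, (x - c)) ^ (p / 2) = a} : ℝ) ≤ p / 2 + 7 * #S * √p := by
  have hm : 1 ≤ #S := hS.card_pos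
  have hp100 : 100 ≤ p := by nlinarith
  set m := #S with hmdef
  set l := Nat.sqrt p with hldef
  have hl1 : l * l ≤ p := Nat.sqrt_le p
  have hl2 : p < (l + 1) * (l + 1) := Nat.lt_succ_sqrt p
  have hlm : 10 * m ≤ l := Nat.le_sqrt.mpr (by nlinarith)
  obtain ⟨d, hd⟩ : ∃ d, d = p / 2 - m := ⟨_, rfl⟩
  obtain ⟨n, hn⟩ : ∃ n, n = l / 2 + 4 * m := ⟨_, rfl⟩
  have hmp : 100 * m ≤ p := by nlinarith
  have hd1 : 48 * p ≤ 100 * d := by omega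
  have hn1 : l + 8 * m ≤ 2 * n + 1 := by omega
  have hn2 : 2 * n ≤ l + 8 * m := by omega
  have hlt : l * (d + l * m + n) < 2 * d * n := by
    have e1 : d * (l + 8 * m) ≤ d * (2 * n + 1) := Nat.mul_le_mul_left _ hn1
    have e2 : l * (2 * n) ≤ l * (l + 8 * m) := Nat.mul_le_mul_left _ hn2
    have e3 : l * (10 * m) ≤ l * l := Nat.mul_le_mul_left _ hlm
    have e4 : l * l * m ≤ p * m := Nat.mul_le_mul_right _ hl1
    have e5 : 48 * p * m ≤ 100 * d * m := Nat.mul_le_mul_right _ hd1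
    have e6 : p * 1 ≤ p * m := Nat.mul_le_mul_left _ hm
    have e7 : d * 1 ≤ d * m := Nat.mul_le_mul_left _ hm
    nlinarith
  have key := mul_card_filter_pow_eq_le (by omega : p ≠ 2) hS h0 (d := d) (n := n) (l := l)
    (by omega) (by nlinarith) (by omega) hlt a
  set N := #{x : ZMod p | (∏ c ∈ S, (x - c)) ^ (p / 2) = a}
  have key2 : 2 * (l * N) ≤ 2 * l * m + p * m + p + p * (l + 8 * m) := by
    have e1 : 2 * (p / 2) * m ≤ p * m := Nat.mul_le_mul_right _ (by omega)
    have e2 : 2 * d ≤ p := by omega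
    have e3 : p * (2 * n) ≤ p * (l + 8 * m) := Nat.mul_le_mul_left _ hn2
    nlinarith
  have key3 : (2 : ℝ) * (l * N) ≤ 2 * l * m + p * m + p + p * (l + 8 * m) := by exact_mod_cast key2
  have hq : √(p : ℝ) * √p = p := Real.mul_self_sqrt (Nat.cast_nonneg p)
  have hq10 : 10 ≤ √(p : ℝ) := Real.le_sqrt_of_sq_le (by norm_num; exact_mod_cast hp100)
  have hql : √(p : ℝ) ≤ l + 1 := by
    rw [Real.sqrt_le_left (by positivity)]
    have : (p : ℝ) < (l + 1) * (l + 1) := by exact_mod_cast hl2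
    nlinarith
  set q := √(p : ℝ)
  have hmR : (1 : ℝ) ≤ m := by exact_mod_cast hm
  have hl0 : (0 : ℝ) < l := by linarith
  rw [← hq] at key3 ⊢
  refine le_of_mul_le_mul_left ?_ hl0
  have e1 : q * (q / 10 * 9) ≤ q * l := by gcongr; linarith
  have e2 : q * q ≤ q * q * m := le_mul_of_one_le_right (by positivity) hmR
  have e3 : l * (10 : ℝ) ≤ l * q := by gcongr
  have e4 : (5 * (q * q) + l) * m ≤ (7 * q * l) * m := by
    gcongr
    nlinarith
  nlinarith

lemma card_filter_prod_add_pow_eq_le {D : Finset (ZMod p)} (hD : D.Nonempty)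
    (hDp : 100 * #D ^ 2 ≤ p) (a : ZMod p) :
    (#{x : ZMod p | (∏ c ∈ D, (x + c)) ^ (p / 2) = a} : ℝ) ≤ p / 2 + 7 * #D * √p := by
  have hm : 1 ≤ #D := hD.card_pos
  obtain ⟨u, hu⟩ : ∃ u, u ∉ D.image (fun c => -c) := by
    by_contra! h
    have h1 : #(univ : Finset (ZMod p)) ≤ #D :=
      (card_le_card fun x _ => h x).trans card_image_le
    rw [card_univ, ZMod.card] at h1
    nlinarith
  have hinj : Function.Injective fun c : ZMod p => -(u + c) := fun x y h => by simpa using h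
  have hcard : #(D.image fun c => -(u + c)) = #D := card_image_of_injective _ hinj
  have h0 : (0 : ZMod p) ∉ D.image fun c => -(u + c) := by
    intro h
    obtain ⟨c, hc, hc0⟩ := mem_image.mp h
    exact hu (mem_image.mpr ⟨c, hc, by linear_combination hc0⟩)
  have := card_filter_pow_eq_le_of_zero_notMem (hD.image _) h0 (by rwa [hcard]) a
  rw [hcard] at this
  refine le_trans (le_of_eq ?_) this
  congr 1
  refine card_bij' (fun x _ => x - u) (fun x _ => x + u) ?_ ?_ ?_ ?_
  · intro x hx
    rw [mem_filter] at hx ⊢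
    refine ⟨mem_univ _, ?_⟩
    rw [← hx.2, prod_image hinj.injOn]
    congr 1
    exact prod_congr rfl fun c _ => by ring
  · intro x hx
    rw [mem_filter] at hx ⊢
    refine ⟨mem_univ _, ?_⟩
    rw [← hx.2, prod_image hinj.injOn]
    congr 1
    exact prod_congr rfl fun c _ => by ring
  · simp
  · simp

end Stepanov

section QuadraticCharacter

variable {p : ℕ} [Fact p.Prime]

lemma abs_sum_quadraticChar_prod_le {D : Finset (ZMod p)} (hD : D.Nonempty)
    (hDp : 100 * #D ^ 2 ≤ p) :
    |∑ x : ZMod p, (quadraticChar (ZMod p) (∏ c ∈ D, (x + c)) : ℝ)| ≤ 15 * #D * √p := by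
  have hm : 1 ≤ #D := hD.card_pos
  have hp2 : p ≠ 2 := by nlinarith
  have hchar : ringChar (ZMod p) ≠ 2 := by rwa [ZMod.ringChar_zmod_n]
  set P : ZMod p → ZMod p := fun x => ∏ c ∈ D, (x + c) with hP
  have hne : (1 : ZMod p) ≠ -1 := (Ring.neg_one_ne_one_of_char_ne_two hchar).symm
  have hchi : ∀ y : ZMod p, (quadraticChar (ZMod p) y : ℝ) =
      (if y ^ (p / 2) = 1 then 1 else 0) - (if y ^ (p / 2) = -1 then 1 else 0) := by
    intro y
    by_cases hy : y = 0
    · subst hy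
      have : p / 2 ≠ 0 := by have := (Fact.out : p.Prime).two_le; omega
      simp [this, zero_pow]
    · have h1 := quadraticChar_eq_pow_of_char_ne_two hchar hy
      rw [ZMod.card] at h1
      have h2 := FiniteField.pow_dichotomy hchar hy
      rw [ZMod.card] at h2
      rw [h1]
      rcases h2 with h2 | h2
      · simp [h2, hne]
      · simp [h2, hne.symm]
  have hsum : ∑ x : ZMod p, (quadraticChar (ZMod p) (P x) : ℝ) =
      #{x : ZMod p | P x ^ (p / 2) = 1} - #{x : ZMod p | P x ^ (p / 2) = -1} := by
    simp only [hchi, sum_sub_distrib, sum_boole]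
  have hz : #{x : ZMod p | P x = 0} ≤ #D := by
    refine (card_le_card ?_).trans (card_image_le (s := D) (f := fun c => -c))
    intro x hx
    rw [mem_filter] at hx
    obtain ⟨c, hc, h⟩ := prod_eq_zero_iff.mp hx.2
    exact mem_image.mpr ⟨c, hc, by linear_combination -h⟩
  have htot : p ≤ #{x : ZMod p | P x ^ (p / 2) = 1} + #{x : ZMod p | P x ^ (p / 2) = -1} +
      #{x : ZMod p | P x = 0} := by
    calc p = #(univ : Finset (ZMod p)) := by rw [card_univ, ZMod.card]
      _ ≤ #((univ.filter fun x => P x ^ (p / 2) = 1) ∪ (univ.filter fun x => P x ^ (p / 2) = -1) ∪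
          (univ.filter fun x => P x = 0)) := by
        refine card_le_card fun x _ => ?_
        simp only [mem_union, mem_filter, mem_univ, true_and]
        by_cases hx : P x = 0
        · exact Or.inr hx
        · left
          have h2 := FiniteField.pow_dichotomy hchar hx
          rwa [ZMod.card] at h2
      _ ≤ _ := (card_union_le _ _).trans (by gcongr; exact card_union_le _ _)
  have h1 := card_filter_prod_add_pow_eq_le hD hDp 1
  have h2 := card_filter_prod_add_pow_eq_le hD hDp (-1)
  have htotR : (p : ℝ) ≤ #{x : ZMod p | P x ^ (p / 2) = 1} +
      #{x : ZMod p | P x ^ (p / 2) = -1} + #D := by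
    exact_mod_cast htot.trans (Nat.add_le_add_left hz _)
  have hmq : (#D : ℝ) ≤ #D * √(p : ℝ) := by
    refine le_mul_of_one_le_right (by positivity) (Real.one_le_sqrt.mpr ?_)
    exact_mod_cast (Fact.out : p.Prime).one_lt.le
  rw [hsum, abs_le]
  constructor <;> linarith

lemma abs_card_forall_isSquare_add_sub_le {S : Finset (ZMod p)} (hS : S.Nonempty)
    (hSp : 100 * #S ^ 2 ≤ p) :
    |(#{x : ZMod p | ∀ c ∈ S, IsSquare (x + c)} : ℝ) - p / 2 ^ #S| ≤ 16 * #S * √p := by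
  classical
  have hm : 1 ≤ #S := hS.card_pos
  have hmR : (1 : ℝ) ≤ #S := by exact_mod_cast hm
  have hp1 : 1 ≤ √(p : ℝ) := by
    refine Real.one_le_sqrt.mpr ?_
    exact_mod_cast (Fact.out : p.Prime).one_lt.le
  set χ : ZMod p → ℝ := fun y => (quadraticChar (ZMod p) y : ℝ) with hχ
  have hχ1 : ∀ y, -1 ≤ χ y ∧ χ y ≤ 1 := by
    intro y
    by_cases hy : y = 0
    · simp [hχ, hy]
    · rcases quadraticChar_dichotomy hy with h | h <;> simp only [hχ, h] <;> norm_num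
  have hexp : |∑ x : ZMod p, ∏ c ∈ S, (1 + χ (x + c)) - p| ≤ 2 ^ #S * (15 * #S * √p) := by
    have h1 : ∑ x : ZMod p, ∏ c ∈ S, (1 + χ (x + c)) =
        ∑ D ∈ S.powerset, ∑ x : ZMod p, (quadraticChar (ZMod p) (∏ c ∈ D, (x + c)) : ℝ) := by
      rw [sum_comm]
      refine sum_congr rfl fun x _ => ?_
      rw [prod_one_add]
      refine sum_congr rfl fun D _ => ?_
      rw [map_prod, Int.cast_prod]
    rw [h1, ← add_sum_erase _ _ (empty_mem_powerset S)]
    simp only [prod_empty, map_one, Int.cast_one, sum_const, card_univ, ZMod.card, nsmul_eq_mul,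
      mul_one, add_sub_cancel_left]
    refine (abs_sum_le_sum_abs _ _).trans ?_
    refine (sum_le_card_nsmul _ _ (15 * #S * √p) fun D hD => ?_).trans ?_
    · obtain ⟨hD0, hDS⟩ := mem_erase.mp hD
      have hle : #D ≤ #S := card_le_card (mem_powerset.mp hDS)
      refine (abs_sum_quadraticChar_prod_le (nonempty_iff_ne_empty.mpr hD0) ?_).trans ?_
      · exact le_trans (by gcongr) hSp
      · gcongr
    · rw [nsmul_eq_mul]
      gcongr
      have : #(S.powerset.erase ∅) ≤ 2 ^ #S := (card_erase_le).trans (card_powerset S).le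
      exact_mod_cast this
  have hdiff : |(#{x : ZMod p | ∀ c ∈ S, IsSquare (x + c)} : ℝ) -
      ∑ x : ZMod p, ∏ c ∈ S, ((1 + χ (x + c)) / 2)| ≤ #S := by
    have hz : #{x : ZMod p | ∏ c ∈ S, (x + c) = 0} ≤ #S := by
      refine (card_le_card ?_).trans (card_image_le (s := S) (f := fun c => -c))
      intro x hx
      rw [mem_filter] at hx
      obtain ⟨c, hc, h⟩ := prod_eq_zero_iff.mp hx.2
      exact mem_image.mpr ⟨c, hc, by linear_combination -h⟩
    rw [← sum_boole, ← sum_sub_distrib]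
    refine (abs_sum_le_sum_abs _ _).trans ?_
    refine le_trans ?_ (show (#{x : ZMod p | ∏ c ∈ S, (x + c) = 0} : ℝ) ≤ #S by exact_mod_cast hz)
    rw [← sum_boole]
    refine sum_le_sum fun x _ => ?_
    by_cases hx0 : ∏ c ∈ S, (x + c) = 0
    · rw [if_pos hx0]
      have h0 : 0 ≤ ∏ c ∈ S, ((1 + χ (x + c)) / 2) :=
        prod_nonneg fun c _ => by linarith [(hχ1 (x + c)).1]
      have h1 : ∏ c ∈ S, ((1 + χ (x + c)) / 2) ≤ 1 :=
        prod_le_one (fun c _ => by linarith [(hχ1 (x + c)).1])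
          fun c _ => by linarith [(hχ1 (x + c)).2]
      rw [abs_le]
      split_ifs <;> constructor <;> linarith
    · rw [if_neg hx0]
      refine le_of_eq (abs_eq_zero.mpr (sub_eq_zero.mpr ?_))
      have hne : ∀ c ∈ S, x + c ≠ 0 := fun c hc h => hx0 (prod_eq_zero hc h)
      by_cases hall : ∀ c ∈ S, IsSquare (x + c)
      · rw [if_pos hall]
        refine (prod_eq_one fun c hc => ?_).symm
        simp only [hχ, (quadraticChar_one_iff_isSquare (hne c hc)).mpr (hall c hc)]
        norm_num
      · rw [if_neg hall]
        push Not at hall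
        obtain ⟨c, hc, hsq⟩ := hall
        refine (prod_eq_zero hc ?_).symm
        simp only [hχ, quadraticChar_neg_one_iff_not_isSquare.mpr hsq]
        norm_num
  have hprod : ∑ x : ZMod p, ∏ c ∈ S, ((1 + χ (x + c)) / 2) =
      (∑ x : ZMod p, ∏ c ∈ S, (1 + χ (x + c))) / 2 ^ #S := by
    rw [sum_div]
    refine sum_congr rfl fun x _ => ?_
    rw [prod_div_distrib, prod_const]
  rw [hprod] at hdiff
  have h2 : |(∑ x : ZMod p, ∏ c ∈ S, (1 + χ (x + c))) / 2 ^ #S - p / 2 ^ #S| ≤ 15 * #S * √p := by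
    rw [← sub_div, abs_div, abs_of_pos (by positivity : (0 : ℝ) < 2 ^ #S),
      div_le_iff₀ (by positivity), mul_comm]
    exact hexp
  have h3 : (#S : ℝ) ≤ #S * √p := le_mul_of_one_le_right (by positivity) hp1
  refine (abs_sub_le _ _ _).trans ((add_le_add hdiff h2).trans ?_)
  linarith

end QuadraticCharacter

/-- The number of `x : A` such that all the shifts `x + c`, `c ∈ S`, are squares. -/
noncomputable def squareShiftCount (A : Type*) [CommRing A] (S : Finset ℕ) : ℕ :=
  Nat.card {x : A // ∀ c ∈ S, IsSquare (x + c)}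

lemma squareShiftCount_congr {A B : Type*} [CommRing A] [CommRing B] (e : A ≃+* B)
    (S : Finset ℕ) : squareShiftCount A S = squareShiftCount B S := by
  refine Nat.card_congr (e.toEquiv.subtypeEquiv fun x => ?_)
  refine forall₂_congr fun c _ => ?_
  rw [RingEquiv.toEquiv_eq_coe, EquivLike.coe_coe, ← map_natCast e c, ← map_add]
  exact ⟨fun h => h.map e, fun h => by simpa using h.map e.symm⟩

lemma squareShiftCount_pi {ι : Type*} [Fintype ι] (A : ι → Type*) [∀ i, CommRing (A i)]
    (S : Finset ℕ) : squareShiftCount (∀ i, A i) S = ∏ i, squareShiftCount (A i) S := by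
  unfold squareShiftCount
  rw [← Nat.card_pi]
  refine Nat.card_congr (Equiv.trans (Equiv.subtypeEquivRight fun x => ?_)
    Equiv.subtypePiEquivPi)
  constructor
  · rintro h i c hc
    obtain ⟨y, hy⟩ := h c hc
    exact ⟨y i, by simpa using congrFun hy i⟩
  · intro h c hc
    choose y hy using fun i => h i c hc
    exact ⟨y, funext fun i => by simpa using hy i⟩

lemma squareShiftCount_zmod_of_squarefree {m : ℕ} (hm : Squarefree m) (S : Finset ℕ) :
    squareShiftCount (ZMod m) S = ∏ q ∈ m.primeFactors, squareShiftCount (ZMod q) S := by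
  have hprod : ∏ i : m.primeFactors, (i : ℕ) = m := by
    rw [prod_coe_sort m.primeFactors fun q => q]
    exact Nat.prod_primeFactors_of_squarefree hm
  have hcop : Pairwise (Function.onFun Nat.Coprime fun i : m.primeFactors => (i : ℕ)) := by
    intro i j hij
    exact (Nat.coprime_primes (Nat.prime_of_mem_primeFactors i.2)
      (Nat.prime_of_mem_primeFactors j.2)).mpr fun h => hij (Subtype.ext h)
  rw [← prod_coe_sort m.primeFactors fun q => squareShiftCount (ZMod q) S,
    ← squareShiftCount_pi]
  exact squareShiftCount_congr ((ZMod.ringEquivCongr hprod.symm).trans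
    (ZMod.prodEquivPi _ hcop)) S

lemma abs_squareShiftCount_sub_le {q : ℕ} (hq : q.Prime) {S : Finset ℕ} (hS : S.Nonempty)
    (hSq : ∀ c ∈ S, c < q) (hcard : 100 * #S ^ 2 ≤ q) :
    |(squareShiftCount (ZMod q) S : ℝ) - q / 2 ^ #S| ≤ 16 * #S * √q := by
  classical
  have : Fact q.Prime := ⟨hq⟩
  have hinj : Set.InjOn (fun c : ℕ => (c : ZMod q)) S := by
    intro a ha b hb hab
    have := (ZMod.natCast_eq_natCast_iff' a b q).mp hab
    rwa [Nat.mod_eq_of_lt (hSq a ha), Nat.mod_eq_of_lt (hSq b hb)] at this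
  have hc : #(S.image fun c : ℕ => (c : ZMod q)) = #S := card_image_of_injOn hinj
  have h := abs_card_forall_isSquare_add_sub_le (hS.image fun c : ℕ => (c : ZMod q))
    (by rwa [hc])
  rw [hc] at h
  have heq : squareShiftCount (ZMod q) S =
      #{x : ZMod q | ∀ c ∈ S.image fun c : ℕ => (c : ZMod q), IsSquare (x + c)} := by
    unfold squareShiftCount
    rw [Nat.card_eq_fintype_card, Fintype.card_subtype]
    simp only [forall_mem_image]
  rwa [heq]

lemma abs_squareShiftCount_zmod_sub_le {m : ℕ} (hm : Squarefree m) {S : Finset ℕ}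
    (hS : S.Nonempty) (hSm : ∀ c ∈ S, c < m.minFac) (hcard : 100 * #S ^ 2 ≤ m.minFac)
    (hsmall : #m.primeFactors * (16 * #S * 2 ^ #S / √(m.minFac : ℝ)) ≤ 1) :
    |(squareShiftCount (ZMod m) S : ℝ) - m / 2 ^ (#m.primeFactors * #S)| ≤
      m / 2 ^ (#m.primeFactors * #S) *
        (2 * (#m.primeFactors * (16 * #S * 2 ^ #S / √(m.minFac : ℝ)))) := by
  have hm0 : (0 : ℝ) < m := by exact_mod_cast Nat.pos_of_ne_zero hm.ne_zero
  have hmf : (0 : ℝ) < m.minFac := by exact_mod_cast Nat.minFac_pos m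
  set δ : ℝ := 16 * #S * 2 ^ #S / √(m.minFac : ℝ) with hδ
  have hδ0 : 0 ≤ δ := by positivity
  set ε : ℕ → ℝ := fun q => squareShiftCount (ZMod q) S / (q / 2 ^ #S) - 1 with hε
  have hεδ : ∀ q ∈ m.primeFactors, ‖ε q‖ ≤ δ := by
    intro q hq
    have hqp := Nat.prime_of_mem_primeFactors hq
    have hle : m.minFac ≤ q := Nat.minFac_le_of_dvd hqp.two_le (Nat.dvd_of_mem_primeFactors hq)
    have hleR : (m.minFac : ℝ) ≤ q := by exact_mod_cast hle
    have hq0 : (0 : ℝ) < q := by exact_mod_cast hqp.pos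
    have h := abs_squareShiftCount_sub_le hqp hS (fun c hc => (hSm c hc).trans_le hle)
      (hcard.trans hle)
    have hq1 : (0 : ℝ) < q / 2 ^ #S := by positivity
    have hsq : √(q : ℝ) * √q = q := Real.mul_self_sqrt hq0.le
    have hsq0 : 0 < √(q : ℝ) := Real.sqrt_pos.mpr hq0
    rw [hε, Real.norm_eq_abs]
    simp only
    rw [div_sub_one hq1.ne', abs_div, abs_of_pos hq1]
    calc _ ≤ 16 * #S * √q / (q / 2 ^ #S) := by gcongr
      _ = 16 * #S * 2 ^ #S / √q := by
        nth_rewrite 2 [← hsq]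
        field_simp
      _ ≤ δ := by
        rw [hδ]; gcongr
  have hprod : (squareShiftCount (ZMod m) S : ℝ) =
      m / 2 ^ (#m.primeFactors * #S) * ∏ q ∈ m.primeFactors, (1 + ε q) := by
    have h1 : (m : ℝ) / 2 ^ (#m.primeFactors * #S) =
        ∏ q ∈ m.primeFactors, ((q : ℝ) / 2 ^ #S) := by
      rw [prod_div_distrib, prod_const, ← pow_mul, mul_comm #S, ← Nat.cast_prod,
        Nat.prod_primeFactors_of_squarefree hm]
    rw [h1, ← prod_mul_distrib, squareShiftCount_zmod_of_squarefree hm, Nat.cast_prod]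
    refine prod_congr rfl fun q hq => ?_
    have hq0 : (0 : ℝ) < q := by exact_mod_cast (Nat.prime_of_mem_primeFactors hq).pos
    rw [hε]
    field_simp
    ring
  have hsum : ∑ q ∈ m.primeFactors, ‖ε q‖ ≤ #m.primeFactors * δ := by
    simpa using sum_le_card_nsmul _ _ _ hεδ
  have hnn : (0 : ℝ) ≤ #m.primeFactors * δ := by positivity
  have hexp : Real.exp (#m.primeFactors * δ) - 1 ≤ 2 * (#m.primeFactors * δ) := by
    have := Real.abs_exp_sub_one_le (x := #m.primeFactors * δ) (by rwa [abs_of_nonneg hnn])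
    rw [abs_of_nonneg hnn] at this
    exact (le_abs_self _).trans this
  have hbd : ‖∏ q ∈ m.primeFactors, (1 + ε q) - 1‖ ≤ 2 * (#m.primeFactors * δ) :=
    (norm_prod_one_add_sub_one_le _ _).trans
      ((sub_le_sub_right (Real.exp_le_exp.mpr hsum) 1).trans hexp)
  rw [Real.norm_eq_abs] at hbd
  rw [hprod, ← mul_sub_one, abs_mul, abs_of_pos (by positivity)]
  gcongr

lemma abs_one_sub_pow_sub_sum_le {q : ℝ} (hq0 : 0 ≤ q) (hq1 : q ≤ 1) (N n : ℕ) :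
    |(1 - q) ^ N - ∑ j ∈ range n, N.choose j * (-q) ^ j| ≤ N.choose n * q ^ n := by
  induction N generalizing n with
  | zero =>
    cases n with
    | zero => simp
    | succ n => simp [sum_range_succ']
  | succ N ih =>
    cases n with
    | zero =>
      simp only [range_zero, sum_empty, sub_zero, Nat.choose_zero_right, Nat.cast_one, pow_zero,
        mul_one]
      rw [abs_of_nonneg (by apply pow_nonneg; linarith)]
      exact pow_le_one₀ (by linarith) (by linarith)
    | succ n =>
      have h : (1 - q) ^ (N + 1) - ∑ j ∈ range (n + 1), (N + 1).choose j * (-q) ^ j =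
          ((1 - q) ^ N - ∑ j ∈ range (n + 1), N.choose j * (-q) ^ j) -
            q * ((1 - q) ^ N - ∑ j ∈ range n, N.choose j * (-q) ^ j) := by
        rw [sum_range_succ', sum_range_succ' (fun j => (N.choose j : ℝ) * (-q) ^ j)]
        simp only [Nat.choose_succ_succ, Nat.cast_add, add_mul, sum_add_distrib, pow_succ,
          ← mul_assoc, ← sum_mul]
        simp
        ring
      rw [h]
      refine (abs_sub _ _).trans ?_
      rw [abs_mul, abs_of_nonneg hq0]
      calc _ ≤ N.choose (n + 1) * q ^ (n + 1) + q * (N.choose n * q ^ n) := by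
            gcongr
            · exact ih _
            · exact ih _
        _ = _ := by rw [Nat.choose_succ_succ]; push_cast; ring

/-- Bonferroni's inequalities, as an error bound for truncated inclusion-exclusion. -/
lemma abs_card_filter_forall_not_sub_le {α ι : Type*} [DecidableEq ι] (A : Finset α)
    (P : ι → α → Prop) [∀ i x, Decidable (P i x)] (s : Finset ι) (n : ℕ) :
    |(#{x ∈ A | ∀ i ∈ s, ¬P i x} : ℝ) -
      ∑ j ∈ range n, ∑ D ∈ powersetCard j s, (-1) ^ j * (#{x ∈ A | ∀ i ∈ D, P i x} : ℝ)| ≤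
        ∑ D ∈ powersetCard n s, (#{x ∈ A | ∀ i ∈ D, P i x} : ℝ) := by
  have hcount : ∀ j, ∑ D ∈ powersetCard j s, (#{x ∈ A | ∀ i ∈ D, P i x} : ℝ) =
      ∑ x ∈ A, ((#{i ∈ s | P i x}).choose j : ℝ) := by
    intro j
    simp only [← sum_boole]
    rw [sum_comm]
    refine sum_congr rfl fun x _ => ?_
    rw [sum_boole, ← card_powersetCard]
    congr 2
    ext D
    simp only [mem_filter, mem_powersetCard, subset_iff]
    grind
  have hzero : (#{x ∈ A | ∀ i ∈ s, ¬P i x} : ℝ) =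
      ∑ x ∈ A, (1 - 1 : ℝ) ^ #{i ∈ s | P i x} := by
    rw [← sum_boole]
    refine sum_congr rfl fun x _ => ?_
    rw [sub_self, zero_pow_eq]
    simp only [card_eq_zero, filter_eq_empty_iff]
  simp only [← mul_sum, hcount]
  rw [hzero]
  simp only [mul_sum]
  rw [sum_comm, ← sum_sub_distrib]
  refine (abs_sum_le_sum_abs _ _).trans (sum_le_sum fun x _ => ?_)
  have := abs_one_sub_pow_sub_sum_le zero_le_one le_rfl #{i ∈ s | P i x} n
  simpa only [one_pow, mul_one, one_mul, mul_comm] using this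

lemma mem_QR_iff {m : ℕ} [NeZero m] (x : ZMod m) : x ∈ QR m ↔ IsSquare x := by
  unfold QR
  simp only [mem_image, mem_range]
  constructor
  · rintro ⟨a, -, rfl⟩
    exact ⟨a, sq _⟩
  · rintro ⟨y, rfl⟩
    exact ⟨y.val, ZMod.val_lt y, by rw [ZMod.natCast_zmod_val, sq]⟩

lemma univM_eq_univ (m : ℕ) [NeZero m] : univM m = univ := by
  refine eq_univ_of_forall fun x => ?_
  unfold univM
  exact mem_image.mpr ⟨x.val, mem_range.mpr (ZMod.val_lt x), ZMod.natCast_zmod_val x⟩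

lemma abs_card_RNset_sub_sum_le {m : ℕ} [NeZero m] (C₁ C₂ : Finset ℕ) (n : ℕ) :
    |(#(RNset m C₁ C₂) : ℝ) - ∑ j ∈ range n, ∑ D ∈ powersetCard j C₂,
      (-1) ^ j * (squareShiftCount (ZMod m) (C₁ ∪ D) : ℝ)| ≤
        ∑ D ∈ powersetCard n C₂, (squareShiftCount (ZMod m) (C₁ ∪ D) : ℝ) := by
  classical
  have h := abs_card_filter_forall_not_sub_le
    (univ.filter fun x : ZMod m => ∀ c ∈ C₁, IsSquare (x + c))
    (fun (c : ℕ) (x : ZMod m) => IsSquare (x + c)) C₂ n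
  have h1 : RNset m C₁ C₂ = (univ.filter fun x : ZMod m => ∀ c ∈ C₁, IsSquare (x + c)).filter
      fun x : ZMod m => ∀ c ∈ C₂, ¬IsSquare (x + c) := by
    ext x
    simp [RNset, univM_eq_univ, mem_QR_iff]
  have h2 : ∀ D : Finset ℕ, squareShiftCount (ZMod m) (C₁ ∪ D) =
      #((univ.filter fun x : ZMod m => ∀ c ∈ C₁, IsSquare (x + c)).filter
        fun x : ZMod m => ∀ c ∈ D, IsSquare (x + c)) := by
    intro D
    unfold squareShiftCount
    rw [Nat.card_eq_fintype_card, Fintype.card_subtype, filter_filter]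
    simp only [mem_union, or_imp, forall_and]
  simp only [h1, h2]
  exact h

lemma sum_range_choose_mul_pow_le {y : ℝ} (hy : 0 ≤ y) (N n : ℕ) :
    ∑ j ∈ range n, N.choose j * y ^ j ≤ (1 + y) ^ N := by
  have h : (1 + y) ^ N = ∑ j ∈ range (N + 1), N.choose j * y ^ j := by
    rw [add_comm, add_pow]
    exact sum_congr rfl fun j _ => by rw [one_pow]; ring
  rw [h, ← sum_filter_add_sum_filter_not (range n) (· ∈ range (N + 1)),
    sum_eq_zero (s := (range n).filter (· ∉ range (N + 1))), add_zero]
  · exact sum_le_sum_of_subset_of_nonneg (fun x hx => (mem_filter.mp hx).2)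
      fun _ _ _ => by positivity
  · intro j hj
    simp only [mem_filter, mem_range] at hj
    rw [Nat.choose_eq_zero_of_lt (by omega)]
    simp

lemma choose_mul_pow_le {y : ℝ} (hy : 0 ≤ y) (N n : ℕ) :
    N.choose n * y ^ n ≤ (1 + y) ^ N :=
  (single_le_sum (f := fun j => (N.choose j : ℝ) * y ^ j) (fun _ _ => by positivity)
    (self_mem_range_succ n)).trans (sum_range_choose_mul_pow_le hy N (n + 1))

lemma exists_forall_log_le_rpow : ∃ N : ℕ, 2 ≤ N ∧ ∀ p : ℕ, N ≤ p →
    128 * (3 + Real.log p) ≤ (p : ℝ) ^ (0.01 : ℝ) := by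
  have h1 : ∀ᶠ x : ℝ in Filter.atTop, ‖Real.log x‖ ≤ 1 / 256 * ‖x ^ (0.01 : ℝ)‖ :=
    (isLittleO_log_rpow_atTop (by norm_num : (0 : ℝ) < 0.01)).def (by norm_num)
  have h2 : ∀ᶠ x : ℝ in Filter.atTop, 768 ≤ x ^ (0.01 : ℝ) :=
    (tendsto_rpow_atTop (by norm_num : (0 : ℝ) < 0.01)).eventually_ge_atTop 768
  obtain ⟨N, hN⟩ := Filter.eventually_atTop.mp
    (tendsto_natCast_atTop_atTop.eventually (h1.and h2))
  refine ⟨max N 2, le_max_right _ _, fun p hp => ?_⟩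
  obtain ⟨h3, h4⟩ := hN p ((le_max_left _ _).trans hp)
  rw [Real.norm_eq_abs, Real.norm_of_nonneg (by positivity)] at h3
  have := le_abs_self (Real.log p)
  linarith

lemma exists_truncation_level {x : ℝ} (hx : 1 ≤ x)
    (hlog : 128 * (3 + Real.log x) ≤ x ^ (0.01 : ℝ)) :
    ∃ n : ℕ, 128 * (n + 2 : ℝ) ≤ x ^ (0.01 : ℝ) ∧ (2 : ℝ) ^ n ≤ 2 * x ^ (0.48 : ℝ) ∧
      x ^ (0.48 : ℝ) ≤ 2 ^ n := by
  obtain ⟨k, hk1, hk2⟩ := exists_nat_pow_near (Real.one_le_rpow hx (by norm_num : (0 : ℝ) ≤ 0.48))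
    (one_lt_two)
  refine ⟨k + 1, ?_, by rw [pow_succ]; linarith, hk2.le⟩
  have h := Real.log_le_log (by positivity) hk1
  rw [Real.log_pow, Real.log_rpow (by linarith)] at h
  have hl2 := Real.log_two_gt_d9
  have hx0 := Real.log_nonneg hx
  have hk : (k : ℝ) * 0.48 ≤ k * Real.log 2 := by gcongr; linarith
  push_cast
  linarith

lemma abs_squareShiftCount_pair_union_sub_le {m : ℕ} (hm : Squarefree m) {l : ℕ} (hl0 : 0 < l)
    (hl : l < m.minFac) {D : Finset ℕ} (hD : Disjoint ({0, l} : Finset ℕ) D)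
    (hDm : ∀ c ∈ D, c < m.minFac) {n : ℕ} (hDn : #D ≤ n) (hn : 100 * (n + 2) ^ 2 ≤ m.minFac)
    {η : ℝ} (hη : η = 128 * #m.primeFactors * (n + 2) / √(m.minFac : ℝ))
    (hηn : η * 2 ^ n ≤ 2) :
    |(squareShiftCount (ZMod m) ({0, l} ∪ D) : ℝ) -
      m * ((2 ^ #m.primeFactors)⁻¹) ^ 2 * ((2 ^ #m.primeFactors)⁻¹) ^ #D| ≤
        m * ((2 ^ #m.primeFactors)⁻¹) ^ 2 * ((2 ^ #m.primeFactors)⁻¹) ^ #D * (η * 2 ^ #D) := by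
  have hcard : #({0, l} ∪ D) = #D + 2 := by
    rw [card_union_of_disjoint hD, card_pair hl0.ne, add_comm]
  have hlt : ∀ c ∈ ({0, l} ∪ D : Finset ℕ), c < m.minFac := by
    intro c hc
    rcases mem_union.mp hc with h | h
    · rcases mem_insert.mp h with rfl | h
      · exact hl0.trans hl
      · rwa [mem_singleton.mp h]
    · exact hDm c h
  have hmf : 0 < √(m.minFac : ℝ) := Real.sqrt_pos.mpr (by exact_mod_cast Nat.minFac_pos m)
  have hDnR : (#D : ℝ) ≤ n := by exact_mod_cast hDn
  have hmain : (m : ℝ) / 2 ^ (#m.primeFactors * (#D + 2)) =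
      m * ((2 ^ #m.primeFactors)⁻¹) ^ 2 * ((2 ^ #m.primeFactors)⁻¹) ^ #D := by
    rw [pow_mul, pow_add, div_eq_mul_inv, mul_inv, inv_pow, inv_pow]
    ring
  have herr : 2 * (#m.primeFactors * (16 * ((#D + 2 : ℕ) : ℝ) * 2 ^ (#D + 2) /
      √(m.minFac : ℝ))) ≤ η * 2 ^ #D := by
    calc _ = 128 * #m.primeFactors * (#D + 2) / √(m.minFac : ℝ) * 2 ^ #D := by
          push_cast; ring
      _ ≤ η * 2 ^ #D := by rw [hη]; gcongr
  have hη0 : 0 ≤ η := by rw [hη]; positivity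
  have hηD : η * 2 ^ #D ≤ η * 2 ^ n := by
    gcongr
    exact one_le_two
  have h := abs_squareShiftCount_zmod_sub_le hm (S := {0, l} ∪ D) ⟨0, by simp⟩ hlt
    (by rw [hcard]; exact le_trans (by gcongr) hn) (by rw [hcard]; linarith)
  rw [hcard, hmain] at h
  refine h.trans ?_
  gcongr

lemma abs_card_RNset_pair_sub_le {m : ℕ} (hm : Squarefree m) {l : ℕ} (hl0 : 0 < l)
    (hl : l < m.minFac) {C₂ : Finset ℕ} (hC : Disjoint ({0, l} : Finset ℕ) C₂)
    (hCm : ∀ c ∈ C₂, c < m.minFac) {n : ℕ} (hn : 100 * (n + 2) ^ 2 ≤ m.minFac)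
    {η : ℝ} (hη : η = 128 * #m.primeFactors * (n + 2) / √(m.minFac : ℝ))
    (hηn : η * 2 ^ n ≤ 2) {q : ℝ} (hq : q = (2 ^ #m.primeFactors)⁻¹) :
    |(#(RNset m {0, l} C₂) : ℝ) - m * q ^ 2 * (1 - q) ^ #C₂| ≤
      m * q ^ 2 * ((1 + 2 * q) ^ #C₂ * (η + 4 * (2 ^ n)⁻¹)) := by
  have : NeZero m := ⟨hm.ne_zero⟩
  have hq0 : 0 ≤ q := by rw [hq]; positivity
  have hq1 : q ≤ 1 := by
    rw [hq]
    exact inv_le_one_of_one_le₀ (one_le_pow₀ one_le_two)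
  have hη0 : 0 ≤ η := by rw [hη]; positivity
  set W : ℝ := m * q ^ 2 with hW
  have hW0 : 0 ≤ W := by positivity
  set G : Finset ℕ → ℝ := fun D => (squareShiftCount (ZMod m) ({0, l} ∪ D) : ℝ) with hG
  have hGD : ∀ j ≤ n, ∀ D ∈ powersetCard j C₂,
      |G D - W * q ^ j| ≤ W * q ^ j * (η * 2 ^ j) := by
    intro j hj D hD
    obtain ⟨hDC, rfl⟩ := mem_powersetCard.mp hD
    have := abs_squareShiftCount_pair_union_sub_le hm hl0 hl
      (hC.mono_right hDC) (fun c hc => hCm c (hDC hc)) hj hn hη hηn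
    rwa [← hq] at this
  have h1 := abs_card_RNset_sub_sum_le (m := m) {0, l} C₂ n
  have h1' : ∑ D ∈ powersetCard n C₂, G D ≤ W * (3 * ((#C₂).choose n * q ^ n)) := by
    refine (sum_le_card_nsmul _ _ (W * q ^ n * 3) fun D hD => ?_).trans (le_of_eq ?_)
    · have h2 := (abs_le.mp (hGD n le_rfl D hD)).2
      have h3 : W * q ^ n * (η * 2 ^ n) ≤ W * q ^ n * 2 := by gcongr
      linarith
    · rw [card_powersetCard, nsmul_eq_mul]; ring
  have h2 : |∑ j ∈ range n, ∑ D ∈ powersetCard j C₂, (-1) ^ j * G D -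
      ∑ j ∈ range n, W * ((#C₂).choose j * (-q) ^ j)| ≤ W * (η * (1 + 2 * q) ^ #C₂) := by
    rw [← sum_sub_distrib]
    calc _ ≤ ∑ j ∈ range n, W * (η * ((#C₂).choose j * (2 * q) ^ j)) := by
          refine (abs_sum_le_sum_abs _ _).trans (sum_le_sum fun j hj => ?_)
          have e1 : ∑ D ∈ powersetCard j C₂, (-1) ^ j * G D -
              W * ((#C₂).choose j * (-q) ^ j) =
              ∑ D ∈ powersetCard j C₂, (-1) ^ j * (G D - W * q ^ j) := by
            rw [← mul_sum, ← mul_sum, sum_sub_distrib, sum_const, card_powersetCard,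
              nsmul_eq_mul, neg_pow]
            ring
          rw [e1]
          refine (abs_sum_le_sum_abs _ _).trans ?_
          refine (sum_le_card_nsmul _ _ (W * q ^ j * (η * 2 ^ j)) fun D hD => ?_).trans
            (le_of_eq ?_)
          · rw [abs_mul, abs_neg_one_pow, one_mul]
            exact hGD j (mem_range.mp hj).le D hD
          · rw [card_powersetCard, nsmul_eq_mul, mul_pow]; ring
      _ = W * (η * ∑ j ∈ range n, (#C₂).choose j * (2 * q) ^ j) := by
          rw [mul_sum, mul_sum]
      _ ≤ _ := by
          gcongr
          exact sum_range_choose_mul_pow_le (by positivity) _ _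
  have h3 : |∑ j ∈ range n, W * ((#C₂).choose j * (-q) ^ j) - W * (1 - q) ^ #C₂| ≤
      W * ((#C₂).choose n * q ^ n) := by
    rw [← mul_sum, ← mul_sub, abs_mul, abs_of_nonneg hW0, abs_sub_comm]
    gcongr
    exact abs_one_sub_pow_sub_sum_le hq0 hq1 _ _
  have h4 : (#C₂).choose n * q ^ n ≤ (1 + 2 * q) ^ #C₂ * ((2 : ℝ) ^ n)⁻¹ := by
    rw [← div_eq_mul_inv, le_div_iff₀ (by positivity), mul_assoc, ← mul_pow, mul_comm q 2]
    exact choose_mul_pow_le (by positivity) _ _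
  have h5 := (abs_sub_le _ _ _).trans (add_le_add (h1.trans h1') ((abs_sub_le _ _ _).trans
    (add_le_add h2 h3)))
  refine h5.trans ?_
  have h6 := mul_le_mul_of_nonneg_left h4 hW0
  linarith

/-- Corollary 2.4: for `m` square-free with `p₁ = P⁻(m)` sufficiently large, `t = ω(m)`,
`C₁ = {0, l}` with `0 < l < p₁`, and `C₂` disjoint from `C₁` with elements below `p₁`,
`s = |C₂| ≤ 0.13·2^t·log p₁` and `t ≤ p₁^0.01`:
`||RN_m(C₁,C₂)| - m·2^(-2t)·(1-2^(-t))^s| ≤ K·m·2^(-2t)·(1+2^(1-t))^s·p₁^(-0.48)`. -/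
theorem stmt_9 :
    ∃ K : ℝ, 0 < K ∧ ∃ N : ℕ,
      ∀ m : ℕ, Squarefree m → N ≤ m.minFac →
        ∀ l : ℕ, 0 < l → l < m.minFac →
          ∀ C₂ : Finset ℕ, Disjoint ({0, l} : Finset ℕ) C₂ → (∀ c ∈ C₂, c < m.minFac) →
            (C₂.card : ℝ) ≤ 0.13 * 2 ^ m.primeFactors.card * Real.log m.minFac →
            (m.primeFactors.card : ℝ) ≤ (m.minFac : ℝ) ^ (0.01 : ℝ) →
            |((RNset m ({0, l} : Finset ℕ) C₂).card : ℝ) -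
                (m : ℝ) * (2 : ℝ) ^ (-(2 * (m.primeFactors.card : ℤ))) *
                  (1 - (2 : ℝ) ^ (-(m.primeFactors.card : ℤ))) ^ C₂.card| ≤
              K * m * (2 : ℝ) ^ (-(2 * (m.primeFactors.card : ℤ))) *
                (1 + (2 : ℝ) ^ (1 - (m.primeFactors.card : ℤ))) ^ C₂.card *
                (m.minFac : ℝ) ^ (-(0.48 : ℝ)) := by
  obtain ⟨N, hN2, hN⟩ := exists_forall_log_le_rpow
  refine ⟨5, by norm_num, N, fun m hm hNm l hl0 hl C₂ hC hCm _ ht => ?_⟩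
  have hx : (1 : ℝ) ≤ m.minFac := by exact_mod_cast Nat.minFac_pos m
  have hx0 : (0 : ℝ) < m.minFac := by linarith
  obtain ⟨n, hn1, hn2, hn3⟩ := exists_truncation_level hx (hN _ hNm)
  set x : ℝ := (m.minFac : ℝ) with hxdef
  set u : ℝ := x ^ (0.01 : ℝ) with hu
  have hu0 : 0 < u := Real.rpow_pos_of_pos hx0 _
  have huu : u * u ≤ x := by
    rw [hu, ← Real.rpow_add hx0]
    exact (Real.rpow_le_rpow_of_exponent_le hx (by norm_num)).trans (Real.rpow_one x).le
  have hn : 100 * (n + 2) ^ 2 ≤ m.minFac := by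
    have : 100 * ((n : ℝ) + 2) ^ 2 ≤ x := by
      have : (128 * (n + 2 : ℝ)) * (128 * (n + 2 : ℝ)) ≤ u * u := by gcongr
      nlinarith
    rw [hxdef] at this
    exact_mod_cast this
  set η : ℝ := 128 * #m.primeFactors * (n + 2) / √x with hη
  have hηle : η ≤ x ^ (-(0.48 : ℝ)) := by
    have h1 : x ^ (-(0.48 : ℝ)) = u * u / √x := by
      rw [hu, Real.sqrt_eq_rpow, ← Real.rpow_add hx0, ← Real.rpow_sub hx0]
      norm_num
    rw [h1, hη]
    refine div_le_div_of_nonneg_right ?_ (Real.sqrt_nonneg x)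
    calc 128 * (#m.primeFactors : ℝ) * (n + 2) = #m.primeFactors * (128 * (n + 2)) := by ring
      _ ≤ u * u := by gcongr
  have hη0 : 0 ≤ η := by positivity
  have hinv : x ^ (-(0.48 : ℝ)) * x ^ (0.48 : ℝ) = 1 := by
    rw [← Real.rpow_add hx0]; norm_num
  have hy0 : 0 < x ^ (-(0.48 : ℝ)) := Real.rpow_pos_of_pos hx0 _
  have hηn : η * 2 ^ n ≤ 2 := by
    calc η * 2 ^ n ≤ x ^ (-(0.48 : ℝ)) * (2 * x ^ (0.48 : ℝ)) := by gcongr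
      _ = 2 := by rw [mul_left_comm, hinv, mul_one]
  have h2n : ((2 : ℝ) ^ n)⁻¹ ≤ x ^ (-(0.48 : ℝ)) := by
    rw [Real.rpow_neg hx0.le]
    gcongr
  set q : ℝ := (2 ^ #m.primeFactors)⁻¹ with hq
  have hq1 : (2 : ℝ) ^ (-(#m.primeFactors : ℤ)) = q := by
    rw [zpow_neg, zpow_natCast]
  have hq2 : (2 : ℝ) ^ (-(2 * (#m.primeFactors : ℤ))) = q ^ 2 := by
    rw [← hq1, ← zpow_natCast, ← zpow_mul]; ring_nf
  have hq3 : (2 : ℝ) ^ (1 - (#m.primeFactors : ℤ)) = 2 * q := by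
    rw [sub_eq_add_neg, zpow_add₀ two_ne_zero, hq1, zpow_one]
  have hq0 : 0 ≤ q := by positivity
  rw [hq1, hq2, hq3]
  refine (abs_card_RNset_pair_sub_le hm hl0 hl hC hCm hn hη hηn hq).trans ?_
  calc m * q ^ 2 * ((1 + 2 * q) ^ #C₂ * (η + 4 * (2 ^ n)⁻¹))
      ≤ m * q ^ 2 * ((1 + 2 * q) ^ #C₂ * (x ^ (-(0.48 : ℝ)) + 4 * x ^ (-(0.48 : ℝ)))) := by
        gcongr
    _ = _ := by ring
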